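/- Suppose the loss function ℓ is symmetric, takes values in [0, M], and obeys the triangle inequality, and suppose f_tr, f_te ∈ ℋ. Fix sample sizes n_tr, n_te ≥ 1 and δ > 0. Then with probability at least 1 − δ over a sample S_tr = (x₁, …, x_{n_tr}) drawn i.i.d. from D_tr and a sample S_te = (x'₁, …, x'_{n_te}) drawn i.i.d. from D_te, the following holds simultaneously for all h ∈ ℋ: ε_te(h) ≤ ε̂_tr(h) + disc(D̂_tr, D̂_te; ℋ, ℓ) + M_cpt^min + R̂_{S_tr}(L_ℋ) + R̂_{S_te}(L_ℋ) + R̂_{S_tr}(ℓ∘ℋ) + 6M·√(log(6/δ)/(2 n_tr)) + 3M·√(log(6/δ)/(2 n_te)). -/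

import Mathlib

open MeasureTheory

/-- Expected loss `L_D(h₁, h₂) = ∫ ℓ(h₁ x, h₂ x) dD(x)`. -/
noncomputable def expLoss {X Y' : Type*} [MeasurableSpace X] (ℓ : Y' → Y' → ℝ)
    (D : Measure X) (h₁ h₂ : X → Y') : ℝ :=
  ∫ x, ℓ (h₁ x) (h₂ x) ∂D

/-- Discrepancy distance `disc(D₁, D₂; ℋ, ℓ)`. -/
noncomputable def disc {X Y' : Type*} [MeasurableSpace X] (ℓ : Y' → Y' → ℝ)
    (H : Set (X → Y')) (D₁ D₂ : Measure X) : ℝ :=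
  sSup {r | ∃ h₁ ∈ H, ∃ h₂ ∈ H, r = |expLoss ℓ D₁ h₁ h₂ - expLoss ℓ D₂ h₁ h₂|}

/-- Empirical distribution `D̂ = (1/n) Σᵢ δ_{xᵢ}` of a sample. -/
noncomputable def empMeasure {X : Type*} [MeasurableSpace X] {n : ℕ} (S : Fin n → X) :
    Measure X :=
  ((n : ENNReal))⁻¹ • ∑ i, Measure.dirac (S i)

/-- Empirical loss `ε̂(h) = (1/n) Σᵢ ℓ(h(xᵢ), f(xᵢ))`. -/
noncomputable def empLoss {X Y' : Type*} (ℓ : Y' → Y' → ℝ) {n : ℕ} (S : Fin n → X)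
    (h f : X → Y') : ℝ :=
  (∑ i, ℓ (h (S i)) (f (S i))) / n

/-- Empirical Rademacher complexity
`R̂_S(G) = (2/n) E_σ [ sup_{g ∈ G} |Σᵢ σᵢ g(zᵢ)| ]` with i.i.d. uniform signs `σᵢ ∈ {±1}`. -/
noncomputable def rademacher {Z : Type*} (G : Set (Z → ℝ)) {n : ℕ} (S : Fin n → Z) : ℝ :=
  (2 / n) * ((2 ^ n : ℝ)⁻¹ *
    ∑ σ : Fin n → Bool,
      sSup {r | ∃ g ∈ G, r = |∑ i, (if σ i then (1 : ℝ) else -1) * g (S i)|})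

/-- The class `L_ℋ = { x ↦ ℓ(h(x), h'(x)) : h, h' ∈ ℋ }`. -/
def lossClass {X Y' : Type*} (ℓ : Y' → Y' → ℝ) (H : Set (X → Y')) : Set (X → ℝ) :=
  {f | ∃ h₁ ∈ H, ∃ h₂ ∈ H, f = fun x => ℓ (h₁ x) (h₂ x)}

/-- The class `ℓ∘ℋ = { (x, y) ↦ ℓ(h(x), y) : h ∈ ℋ }`. -/
def labeledLossClass {X Y' : Type*} (ℓ : Y' → Y' → ℝ) (H : Set (X → Y')) :
    Set (X × Y' → ℝ) :=
  {f | ∃ h ∈ H, f = fun p => ℓ (h p.1) p.2}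

open ProbabilityTheory

section Measure

variable {α β : Type*} [MeasurableSpace α] [MeasurableSpace β]

lemma ofReal_one_sub_le_of_measure_compl_le {μ : Measure α} [IsProbabilityMeasure μ]
    {s : Set α} {p : ℝ} (hp : 0 ≤ p) (hs : μ sᶜ ≤ ENNReal.ofReal p) :
    ENNReal.ofReal (1 - p) ≤ μ s := by
  rw [ENNReal.ofReal_sub _ hp, ENNReal.ofReal_one, tsub_le_iff_right]
  calc (1 : ENNReal) = μ (s ∪ sᶜ) := by simp
    _ ≤ μ s + μ sᶜ := measure_union_le _ _
    _ ≤ _ := by gcongr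

/-- A lower bound for the outer product measure of a set that need not be measurable. -/
lemma mul_le_prod_of_forall_section {μ : Measure α} {ν : Measure β} [SFinite ν]
    {s : Set α} {G : Set (α × β)} {c d : ENNReal} (hs : d ≤ μ s)
    (hG : ∀ x ∈ s, c ≤ ν (Prod.mk x ⁻¹' G)) : c * d ≤ μ.prod ν G := by
  rw [← measure_toMeasurable G, Measure.prod_apply (measurableSet_toMeasurable _ _)]
  refine le_trans ?_ (mul_meas_ge_le_lintegral
    (measurable_measure_prodMk_left (measurableSet_toMeasurable _ _)) c)
  gcongr
  refine hs.trans (measure_mono fun x hx => (hG x hx).trans (measure_mono ?_))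
  exact Set.preimage_mono (subset_toMeasurable _ _)

/-- **Hoeffding's inequality** for an empirical mean, in high-probability form. -/
lemma ofReal_one_sub_le_pi_empirical_mean_le {D : Measure α} [IsProbabilityMeasure D]
    {g : α → ℝ} (hg : AEMeasurable g D) {a M : ℝ} (hM : 0 ≤ M)
    (hb : ∀ x, g x ∈ Set.Icc a (a + M)) {n : ℕ} (hn : 1 ≤ n) {p : ℝ} (hp : 0 < p)
    (hp1 : p ≤ 1) :
    ENNReal.ofReal (1 - p) ≤ (Measure.pi fun _ : Fin n => D)
      {S | (∑ i, g (S i)) / n ≤ ∫ x, g x ∂D + M * Real.sqrt (Real.log (1 / p) / (2 * n))} := by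
  have hn0 : (0 : ℝ) < n := by exact_mod_cast hn
  set t := Real.sqrt (Real.log (1 / p) / (2 * n))
  have ht0 : 0 ≤ t := Real.sqrt_nonneg _
  have hlog : 0 ≤ Real.log (1 / p) := Real.log_nonneg (by rw [le_div_iff₀ hp]; linarith)
  have ht2 : t ^ 2 = Real.log (1 / p) / (2 * n) := Real.sq_sqrt (by positivity)
  refine ofReal_one_sub_le_of_measure_compl_le hp.le ?_
  rcases hM.eq_or_lt with rfl | hM
  · have hga : ∀ x, g x = a := fun x => le_antisymm (by simpa using (hb x).2) (hb x).1
    have : {S : Fin n → α | (∑ i, g (S i)) / n ≤ ∫ x, g x ∂D + 0 * t} = Set.univ := by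
      ext S
      simp [hga, hn0.ne']
    rw [this, Set.compl_univ, measure_empty]
    exact zero_le
  set μ := Measure.pi fun _ : Fin n => D
  have hsub : HasSubgaussianMGF (fun x => g x - ∫ x, g x ∂D) ((‖a + M - a‖₊ / 2) ^ 2) D :=
    hasSubgaussianMGF_of_mem_Icc hg (ae_of_all _ hb)
  have hindep : iIndepFun (fun (i : Fin n) (S : Fin n → α) => g (S i) - ∫ x, g x ∂D) μ :=
    iIndepFun_pi (X := fun _ x => g x - ∫ x, g x ∂D) fun _ => hg.sub_const _
  have hsubi : ∀ i ∈ (Finset.univ : Finset (Fin n)),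
      HasSubgaussianMGF (fun S : Fin n → α => g (S i) - ∫ x, g x ∂D)
        ((‖a + M - a‖₊ / 2) ^ 2) μ := by
    intro i _
    refine HasSubgaussianMGF.of_map (Y := fun S : Fin n → α => S i)
      (X := fun x => g x - ∫ x, g x ∂D) (measurable_pi_apply i).aemeasurable ?_
    rwa [(measurePreserving_eval (fun _ : Fin n => D) i).map_eq]
  have key := HasSubgaussianMGF.measure_sum_ge_le_of_iIndepFun hindep hsubi (ε := n * (M * t)) (by positivity)
  have hexp : Real.exp (-(n * (M * t)) ^ 2 /
      (2 * ((∑ _i : Fin n, (‖a + M - a‖₊ / 2) ^ 2 : NNReal) : ℝ))) = p := by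
    have hnorm : ((∑ _i : Fin n, (‖a + M - a‖₊ / 2) ^ 2 : NNReal) : ℝ) = n * (M / 2) ^ 2 := by
      simp [abs_of_pos hM]
    have : -(n * (M * t)) ^ 2 / (2 * (n * (M / 2) ^ 2)) = Real.log p := by
      rw [mul_pow, mul_pow, ht2, one_div, Real.log_inv]
      field_simp
    rw [hnorm, this, Real.exp_log hp]
  push_cast at key hexp
  rw [hexp] at key
  calc μ _ ≤ μ {S | n * (M * t) ≤ ∑ i, (g (S i) - ∫ x, g x ∂D)} := by
        refine measure_mono fun S hS => ?_
        simp only [Set.mem_compl_iff, Set.mem_ofPred_eq, not_le, lt_div_iff₀ hn0] at hS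
        simp only [Set.mem_ofPred_eq, Finset.sum_sub_distrib, Finset.sum_const,
          Finset.card_univ, Fintype.card_fin, nsmul_eq_mul]
        linarith
    _ ≤ ENNReal.ofReal p := by
        rw [← ofReal_measureReal]
        exact ENNReal.ofReal_le_ofReal key

lemma integral_dirac_of_aestronglyMeasurable {g : α → ℝ} {x : α}
    (hg : AEStronglyMeasurable g (Measure.dirac x)) : ∫ y, g y ∂(Measure.dirac x) = g x := by
  obtain ⟨N, hsub, hN, hN0⟩ := exists_measurable_superset_of_null (ae_iff.1 hg.ae_eq_mk)
  have hx : x ∉ N := fun h => by simp [Measure.dirac_apply' _ hN, h] at hN0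
  have hgx : g x = hg.mk g x := by
    by_contra h
    exact hx (hsub h)
  rw [integral_congr_ae hg.ae_eq_mk, integral_dirac' _ _ hg.stronglyMeasurable_mk, hgx]

lemma ae_aestronglyMeasurable_dirac {D : Measure α} {g : α → ℝ}
    (hg : AEStronglyMeasurable g D) : ∀ᵐ x ∂D, AEStronglyMeasurable g (Measure.dirac x) := by
  obtain ⟨N, hsub, hN, hN0⟩ := exists_measurable_superset_of_null (ae_iff.1 hg.ae_eq_mk)
  have hmem : ∀ᵐ x ∂D, x ∉ N := measure_eq_zero_iff_ae_notMem.1 hN0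
  filter_upwards [hmem] with x hx
  refine ⟨hg.mk g, hg.stronglyMeasurable_mk, measure_mono_null hsub ?_⟩
  simp [Measure.dirac_apply' _ hN, hx]

end Measure

section Loss

variable {X Y' : Type*} {ℓ : Y' → Y' → ℝ} {M : ℝ}

lemma empLoss_nonneg (hnonneg : ∀ a b, 0 ≤ ℓ a b) {n : ℕ} (S : Fin n → X) (h f : X → Y') :
    0 ≤ empLoss ℓ S h f :=
  div_nonneg (Finset.sum_nonneg fun _ _ => hnonneg _ _) n.cast_nonneg

lemma empLoss_le (hbound : ∀ a b, ℓ a b ≤ M) {n : ℕ} (hn : 1 ≤ n)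
    (S : Fin n → X) (h f : X → Y') : empLoss ℓ S h f ≤ M := by
  rw [empLoss, div_le_iff₀ (by exact_mod_cast hn)]
  calc _ ≤ ∑ _i : Fin n, M := Finset.sum_le_sum fun _ _ => hbound _ _
    _ = M * n := by simp [mul_comm]

lemma empLoss_triangle (htri : ∀ a b c, ℓ a c ≤ ℓ a b + ℓ b c) {n : ℕ}
    (S : Fin n → X) (h f g : X → Y') :
    empLoss ℓ S h g ≤ empLoss ℓ S h f + empLoss ℓ S f g := by
  rw [empLoss, empLoss, empLoss, ← add_div, ← Finset.sum_add_distrib]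
  gcongr
  exact htri _ _ _

lemma rademacher_nonneg {Z : Type*} (G : Set (Z → ℝ)) {n : ℕ} (S : Fin n → Z) :
    0 ≤ rademacher G S := by
  refine mul_nonneg (by positivity) (mul_nonneg (by positivity) (Finset.sum_nonneg fun σ _ => ?_))
  exact Real.sSup_nonneg (by rintro r ⟨g, -, rfl⟩; exact abs_nonneg _)

variable [MeasurableSpace X]

lemma expLoss_nonneg (hnonneg : ∀ a b, 0 ≤ ℓ a b) (D : Measure X) (h f : X → Y') :
    0 ≤ expLoss ℓ D h f :=
  integral_nonneg fun _ => hnonneg _ _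

lemma expLoss_le (hnonneg : ∀ a b, 0 ≤ ℓ a b) (hbound : ∀ a b, ℓ a b ≤ M)
    (D : Measure X) [IsProbabilityMeasure D] (h f : X → Y') : expLoss ℓ D h f ≤ M := by
  calc _ ≤ ∫ _x, M ∂D := integral_mono_of_nonneg (ae_of_all _ fun _ => hnonneg _ _)
        (integrable_const _) (ae_of_all _ fun _ => hbound _ _)
    _ = M := by simp

lemma expLoss_triangle {D : Measure X} (htri : ∀ a b c, ℓ a c ≤ ℓ a b + ℓ b c)
    {h f g : X → Y'} (hhg : Integrable (fun x => ℓ (h x) (g x)) D)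
    (hhf : Integrable (fun x => ℓ (h x) (f x)) D) (hfg : Integrable (fun x => ℓ (f x) (g x)) D) :
    expLoss ℓ D h g ≤ expLoss ℓ D h f + expLoss ℓ D f g := by
  rw [expLoss, expLoss, expLoss, ← integral_add hhf hfg]
  exact integral_mono hhg (hhf.add hfg) fun _ => htri _ _ _

lemma isProbabilityMeasure_empMeasure {n : ℕ} (hn : 1 ≤ n) (S : Fin n → X) :
    IsProbabilityMeasure (empMeasure S) := by
  refine ⟨?_⟩
  have : (n : ENNReal) ≠ 0 := by exact_mod_cast (by lia : n ≠ 0)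
  simp [empMeasure, ENNReal.inv_mul_cancel this]

lemma dirac_absolutelyContinuous_empMeasure {n : ℕ} (S : Fin n → X) (i : Fin n) :
    Measure.dirac (S i) ≪ empMeasure S := by
  intro s hs
  rw [empMeasure, Measure.smul_apply, smul_eq_mul, mul_eq_zero] at hs
  have h := hs.resolve_left (by simp)
  rw [Measure.finsetSum_apply, Finset.sum_eq_zero_iff] at h
  exact h i (Finset.mem_univ i)

lemma expLoss_empMeasure (hnonneg : ∀ a b, 0 ≤ ℓ a b) (hbound : ∀ a b, ℓ a b ≤ M)
    {n : ℕ} {S : Fin n → X} {h f : X → Y'}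
    (hm : ∀ i, AEStronglyMeasurable (fun x => ℓ (h x) (f x)) (Measure.dirac (S i))) :
    expLoss ℓ (empMeasure S) h f = empLoss ℓ S h f := by
  have hint : ∀ i ∈ Finset.univ, Integrable (fun x => ℓ (h x) (f x)) (Measure.dirac (S i)) :=
    fun i _ => Integrable.of_bound (hm i) M (ae_of_all _ fun x => by
      rw [Real.norm_of_nonneg (hnonneg _ _)]; exact hbound _ _)
  rw [expLoss, empMeasure, integral_smul_measure, integral_finsetSum_measure hint, empLoss]
  simp only [integral_dirac_of_aestronglyMeasurable (hm _)]
  simp [div_eq_inv_mul]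

/-- When the integrand is not a.e. measurable for the empirical measure, the left-hand side
is `0`. -/
lemma expLoss_empMeasure_le (hnonneg : ∀ a b, 0 ≤ ℓ a b) (hbound : ∀ a b, ℓ a b ≤ M)
    {n : ℕ} (S : Fin n → X) (h f : X → Y') :
    expLoss ℓ (empMeasure S) h f ≤ empLoss ℓ S h f := by
  by_cases hm : AEStronglyMeasurable (fun x => ℓ (h x) (f x)) (empMeasure S)
  · exact (expLoss_empMeasure hnonneg hbound fun i =>
      hm.mono_ac (dirac_absolutelyContinuous_empMeasure S i)).le
  · rw [expLoss, integral_non_aestronglyMeasurable hm]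
    exact empLoss_nonneg hnonneg _ _ _

lemma abs_expLoss_sub_le_disc (hnonneg : ∀ a b, 0 ≤ ℓ a b) (hbound : ∀ a b, ℓ a b ≤ M)
    {H : Set (X → Y')} (D₁ D₂ : Measure X) [IsProbabilityMeasure D₁] [IsProbabilityMeasure D₂]
    {h f : X → Y'} (hh : h ∈ H) (hf : f ∈ H) :
    |expLoss ℓ D₁ h f - expLoss ℓ D₂ h f| ≤ disc ℓ H D₁ D₂ := by
  refine le_csSup ⟨M, ?_⟩ ⟨h, hh, f, hf, rfl⟩
  rintro r ⟨h₁, -, h₂, -, rfl⟩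
  have h1 := expLoss_nonneg hnonneg D₁ h₁ h₂
  have h2 := expLoss_nonneg hnonneg D₂ h₁ h₂
  have h3 := expLoss_le hnonneg hbound D₁ h₁ h₂
  have h4 := expLoss_le hnonneg hbound D₂ h₁ h₂
  rw [abs_le]
  constructor <;> linarith

/-- For a fixed training sample, the expected test loss is controlled, uniformly over the class,
by the empirical training loss and the empirical discrepancy. The function nearly maximizing
the gap between the two losses does not depend on the test sample, so concentration is needed
for that function only. -/
lemma ofReal_one_sub_le_pi_expLoss_le_empLoss_add_disc
    (hnonneg : ∀ a b, 0 ≤ ℓ a b) (hbound : ∀ a b, ℓ a b ≤ M)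
    {H : Set (X → Y')} {D : Measure X} [IsProbabilityMeasure D] {f : X → Y'} (hf : f ∈ H)
    (hint : ∀ h ∈ H, Integrable (fun x => ℓ (h x) (f x)) D)
    {m n : ℕ} (hm : 1 ≤ m) (hn : 1 ≤ n) {p : ℝ} (hp : 0 < p) (hp1 : p < 1) (S : Fin m → X) :
    ENNReal.ofReal (1 - p) ≤ (Measure.pi fun _ : Fin n => D) {T | ∀ h ∈ H,
      expLoss ℓ D h f ≤ empLoss ℓ S h f + disc ℓ H (empMeasure S) (empMeasure T)
        + 2 * M * Real.sqrt (Real.log (1 / p) / (2 * n))} := by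
  have hn0 : (0 : ℝ) < n := by exact_mod_cast hn
  obtain ⟨x₀⟩ : Nonempty X := ⟨S ⟨0, hm⟩⟩
  have hM : 0 ≤ M := (hnonneg (f x₀) (f x₀)).trans (hbound _ _)
  set t := Real.sqrt (Real.log (1 / p) / (2 * n))
  have ht0 : 0 < t := by
    have : 0 < Real.log (1 / p) := Real.log_pos (by rw [lt_div_iff₀ hp]; linarith)
    positivity
  obtain ⟨h₀, hh₀, hmax⟩ : ∃ h₀ ∈ H, ∀ h ∈ H, expLoss ℓ D h f - empLoss ℓ S h f ≤
      expLoss ℓ D h₀ f - empLoss ℓ S h₀ f + M * t := by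
    rcases hM.eq_or_lt with rfl | hMpos
    · refine ⟨f, hf, fun h _ => ?_⟩
      have h0 : ∀ a b, ℓ a b = 0 := fun a b => le_antisymm (hbound a b) (hnonneg a b)
      simp [expLoss, empLoss, h0]
    · set V := (fun h => expLoss ℓ D h f - empLoss ℓ S h f) '' H
      have hV : BddAbove V := by
        refine ⟨M, ?_⟩
        rintro _ ⟨h, -, rfl⟩
        have := expLoss_le hnonneg hbound D h f
        have := empLoss_nonneg hnonneg S h f
        dsimp only
        linarith
      obtain ⟨_, ⟨h₀, hh₀, rfl⟩, hlt⟩ :=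
        exists_lt_of_lt_csSup (s := V) ⟨_, f, hf, rfl⟩ (sub_lt_self _ (mul_pos hMpos ht0))
      refine ⟨h₀, hh₀, fun h hh => ?_⟩
      have := le_csSup hV ⟨h, hh, rfl⟩
      dsimp only at this hlt
      linarith
  have hhoeff := ofReal_one_sub_le_pi_empirical_mean_le (D := D)
    (g := fun x => -ℓ (h₀ x) (f x)) (hint h₀ hh₀).aestronglyMeasurable.aemeasurable.neg hM
    (a := -M) (fun x => ⟨neg_le_neg (hbound _ _), by simpa using hnonneg _ _⟩) hn hp hp1.le
  have hmeas : ∀ᵐ T ∂(Measure.pi fun _ : Fin n => D), ∀ i,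
      AEStronglyMeasurable (fun x => ℓ (h₀ x) (f x)) (Measure.dirac (T i)) :=
    ae_all_iff.2 fun i => (Measure.quasiMeasurePreserving_eval (fun _ : Fin n => D) i).ae
      (ae_aestronglyMeasurable_dirac (hint h₀ hh₀).aestronglyMeasurable)
  refine hhoeff.trans (measure_mono_ae ?_)
  filter_upwards [hmeas] with T hT hTmean h hh
  have hmean : -empLoss ℓ T h₀ f ≤ -expLoss ℓ D h₀ f + M * t := by
    have hle : (∑ i, -ℓ (h₀ (T i)) (f (T i))) / n ≤ ∫ x, -ℓ (h₀ x) (f x) ∂D + M * t := hTmean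
    simpa [empLoss, expLoss, neg_div, integral_neg] using hle
  have := isProbabilityMeasure_empMeasure hm S
  have := isProbabilityMeasure_empMeasure hn T
  have hdisc := (neg_le_abs _).trans (abs_expLoss_sub_le_disc hnonneg hbound
    (empMeasure S) (empMeasure T) hh₀ hf)
  rw [expLoss_empMeasure hnonneg hbound hT] at hdisc
  have hS := expLoss_empMeasure_le hnonneg hbound S h₀ f
  have := hmax h hh
  linarith

end Loss

/-- Empirical upper generalization bound: with probability at least `1 − δ` over i.i.d.
samples `S_tr ∼ D_tr^{n_tr}` and `S_te ∼ D_te^{n_te}`, for all `h ∈ ℋ`,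
`ε_te(h) ≤ ε̂_tr(h) + disc(D̂_tr, D̂_te) + M_cpt^min + R̂_{S_tr}(L_ℋ) + R̂_{S_te}(L_ℋ)
 + R̂_{S_tr}(ℓ∘ℋ) + 6M√(log(6/δ)/(2n_tr)) + 3M√(log(6/δ)/(2n_te))`. -/
theorem empirical_test_loss_upper_bound {X Y' : Type*} [MeasurableSpace X]
    (ℓ : Y' → Y' → ℝ) (M : ℝ)
    (hnonneg : ∀ a b, 0 ≤ ℓ a b) (hbound : ∀ a b, ℓ a b ≤ M)
    (hsymm : ∀ a b, ℓ a b = ℓ b a)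
    (htri : ∀ a b c, ℓ a c ≤ ℓ a b + ℓ b c)
    (H : Set (X → Y')) (Dtr Dte : Measure X)
    [IsProbabilityMeasure Dtr] [IsProbabilityMeasure Dte]
    (ftr fte : X → Y') (hftr : ftr ∈ H) (hfte : fte ∈ H)
    (hint : ∀ h₁ ∈ H, ∀ h₂ ∈ H,
      Integrable (fun x => ℓ (h₁ x) (h₂ x)) Dtr ∧
      Integrable (fun x => ℓ (h₁ x) (h₂ x)) Dte)
    (ntr nte : ℕ) (hntr : 1 ≤ ntr) (hnte : 1 ≤ nte)
    (δ : ℝ) (hδ : 0 < δ) :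
    ENNReal.ofReal (1 - δ) ≤
      ((Measure.pi fun _ : Fin ntr => Dtr).prod (Measure.pi fun _ : Fin nte => Dte))
        {S : (Fin ntr → X) × (Fin nte → X) | ∀ h ∈ H,
          expLoss ℓ Dte h fte ≤
            empLoss ℓ S.1 h ftr
            + disc ℓ H (empMeasure S.1) (empMeasure S.2)
            + min (expLoss ℓ Dtr ftr fte) (expLoss ℓ Dte ftr fte)
            + rademacher (lossClass ℓ H) S.1
            + rademacher (lossClass ℓ H) S.2
            + rademacher (labeledLossClass ℓ H) (fun i => (S.1 i, ftr (S.1 i)))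
            + 6 * M * Real.sqrt (Real.log (6 / δ) / (2 * ntr))
            + 3 * M * Real.sqrt (Real.log (6 / δ) / (2 * nte))} := by
  rcases le_or_gt 1 δ with hδ1 | hδ1
  · rw [ENNReal.ofReal_eq_zero.2 (by linarith)]
    exact zero_le
  set p := δ / 6 with hp
  have hp0 : 0 < p := by positivity
  have hp1 : p < 1 := by linarith
  have hlog : 6 / δ = 1 / p := by rw [hp]; field_simp
  obtain ⟨x₀⟩ : Nonempty X := Dtr.nonempty_of_neZero
  have hM : 0 ≤ M := (hnonneg (ftr x₀) (ftr x₀)).trans (hbound _ _)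
  have htrain := ofReal_one_sub_le_pi_empirical_mean_le (D := Dtr)
    (g := fun x => ℓ (ftr x) (fte x)) (hint ftr hftr fte hfte).1.aestronglyMeasurable.aemeasurable
    hM (a := 0) (fun x => ⟨hnonneg _ _, by simpa using hbound _ _⟩) hntr hp0 hp1.le
  have hprob : ENNReal.ofReal (1 - δ) ≤ ENNReal.ofReal (1 - p) * ENNReal.ofReal (1 - p) := by
    rw [← ENNReal.ofReal_mul (by linarith)]
    exact ENNReal.ofReal_le_ofReal (by nlinarith)
  refine hprob.trans (mul_le_prod_of_forall_section htrain fun S hS => ?_)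
  rw [hlog]
  have hMs : 0 ≤ M * Real.sqrt (Real.log (1 / p) / (2 * ntr)) := by positivity
  have hMt : 0 ≤ M * Real.sqrt (Real.log (1 / p) / (2 * nte)) := by positivity
  have hS' : empLoss ℓ S ftr fte ≤
      expLoss ℓ Dtr ftr fte + M * Real.sqrt (Real.log (1 / p) / (2 * ntr)) := hS
  have hR₁ := rademacher_nonneg (lossClass ℓ H) S
  have hR₂ := rademacher_nonneg (labeledLossClass ℓ H) (fun i => (S i, ftr (S i)))
  rcases min_choice (expLoss ℓ Dtr ftr fte) (expLoss ℓ Dte ftr fte) with hmin | hmin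
  · refine (ofReal_one_sub_le_pi_expLoss_le_empLoss_add_disc hnonneg hbound hfte
      (fun h hh => (hint h hh fte hfte).2) hntr hnte hp0 hp1 S).trans
      (measure_mono fun T hT h hh => ?_)
    have h1 := hT h hh
    have h2 := empLoss_triangle htri S h ftr fte
    have hR₃ := rademacher_nonneg (lossClass ℓ H) T
    dsimp only
    rw [hmin]
    linarith
  · refine (ofReal_one_sub_le_pi_expLoss_le_empLoss_add_disc hnonneg hbound hftr
      (fun h hh => (hint h hh ftr hftr).2) hntr hnte hp0 hp1 S).trans
      (measure_mono fun T hT h hh => ?_)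
    have h1 := hT h hh
    have h2 := expLoss_triangle htri (hint h hh fte hfte).2 (hint h hh ftr hftr).2
      (hint ftr hftr fte hfte).2
    have hR₃ := rademacher_nonneg (lossClass ℓ H) T
    dsimp only
    rw [hmin]
    linarith
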